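/- The norm equation of the biquadratic field ℚ(√13, √17), written explicitly as (x² + 13·y² − 17·z² − 221·t²)² − 13·(2·x·y − 34·z·t)² = 25, is a counterexample to the Hasse principle: it has a solution with x, y, z, t ∈ ℝ, and for every prime p it has a solution with x, y, z, t ∈ ℚ_p, but it has no solution with x, y, z, t ∈ ℚ. -/

import Mathlib

open NumberTheorySymbols

/-- Hensel's lemma for `X² - d` starting from an integer approximation. -/
lemma hassecx_hensel (p : ℕ) [Fact p.Prime] (d a : ℤ)
    (h : ‖((a ^ 2 - d : ℤ) : ℤ_[p])‖ < ‖((2 * a : ℤ) : ℤ_[p])‖ ^ 2) :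
    ∃ w : ℚ_[p], w ^ 2 = d := by
  have := hensels_lemma (p := p) (R := ℤ) (F := Polynomial.X ^ 2 - Polynomial.C d)
    (a := (a : ℤ_[p])) (by
      simp only [map_sub, map_pow, Polynomial.aeval_X, Polynomial.aeval_C,
        Polynomial.derivative_X_pow, Polynomial.derivative_C]
      have e2 : Polynomial.aeval (a : ℤ_[p]) (2 : Polynomial ℤ) = 2 := map_ofNat _ 2
      simpa [e2] using h)
  obtain ⟨z, hz, -⟩ := this
  refine ⟨(z : ℚ_[p]), ?_⟩
  have hz' : z ^ 2 = (d : ℤ_[p]) := by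
    simpa [sub_eq_zero] using hz
  exact_mod_cast congrArg (fun u : ℤ_[p] => (u : ℚ_[p])) hz'

lemma hassecx_sqrt_lift (p : ℕ) [hp : Fact p.Prime] (h2 : p ≠ 2) (d : ℤ)
    (hd : (d : ZMod p) ≠ 0) (hs : IsSquare (d : ZMod p)) : ∃ w : ℚ_[p], w ^ 2 = d := by
  obtain ⟨r, hr⟩ := hs
  obtain ⟨a, rfl⟩ := ZMod.intCast_surjective r
  apply hassecx_hensel p d a
  have h1 : ‖((2 * a : ℤ) : ℤ_[p])‖ = 1 := by
    apply le_antisymm (PadicInt.norm_le_one _)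
    by_contra hlt
    rw [not_le, PadicInt.norm_int_lt_one_iff_dvd,
      ← ZMod.intCast_zmod_eq_zero_iff_dvd] at hlt
    push_cast at hlt
    rcases mul_eq_zero.1 hlt with h | h
    · have h' : ((2 : ℕ) : ZMod p) = 0 := by exact_mod_cast h
      rw [ZMod.natCast_eq_zero_iff] at h'
      exact h2 ((Nat.prime_dvd_prime_iff_eq hp.out Nat.prime_two).1 h')
    · apply hd; rw [hr, h, mul_zero]
  rw [h1, one_pow, PadicInt.norm_int_lt_one_iff_dvd, ← ZMod.intCast_zmod_eq_zero_iff_dvd]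
  push_cast
  rw [hr]; ring

lemma hassecx_sqrt17_two : ∃ w : ℚ_[2], w ^ 2 = (17 : ℤ) := by
  apply hassecx_hensel 2 17 1
  have e1 : ((1 ^ 2 - 17 : ℤ) : ℤ_[2]) = -((2 : ℕ) : ℤ_[2]) ^ 4 := by push_cast; norm_num
  have e2 : ((2 * 1 : ℤ) : ℤ_[2]) = ((2 : ℕ) : ℤ_[2]) := by push_cast; norm_num
  rw [e1, e2, norm_neg, norm_pow, PadicInt.norm_p]
  norm_num

lemma hassecx_nonsq (p : ℕ) [Fact p.Prime] (u : ℤ_[p]) (h : ¬ ‖u‖ < 1) :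
    (u : ℚ_[p]) ≠ 0 ∧ (u : ℚ_[p]).valuation = 0 := by
  have h1 : ‖u‖ = 1 := le_antisymm (PadicInt.norm_le_one _) (not_lt.1 h)
  have h0 : (u : ℚ_[p]) ≠ 0 := by
    intro h0
    have : ‖(u : ℚ_[p])‖ = 1 := by simpa using h1
    rw [h0] at this; simp at this
  refine ⟨h0, ?_⟩
  have := Padic.norm_eq_zpow_neg_valuation h0
  rw [PadicInt.padic_norm_e_of_padicInt, h1] at this
  have hp : 1 < (p : ℝ) := by exact_mod_cast (Fact.out : p.Prime).one_lt
  have := (zpow_eq_one_iff_right₀ (by linarith) hp.ne').1 this.symm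
  omega

/-- Norms from the unramified extension `ℚ_p(√13)` have even valuation. -/
lemma hassecx_even_val (p : ℕ) [Fact p.Prime] (hn : ¬ IsSquare (13 : ZMod p)) (u v : ℚ_[p])
    (h : u ^ 2 - 13 * v ^ 2 ≠ 0) : Even (u ^ 2 - 13 * v ^ 2).valuation := by
  have e13 : ((13 : ℤ_[p]) : ℚ_[p]) = 13 := rfl
  have key (a : ℤ_[p]) : ‖a‖ < 1 → PadicInt.toZMod a = 0 := by
    intro ha
    have : a ∈ IsLocalRing.maximalIdeal ℤ_[p] := by
      rw [IsLocalRing.mem_maximalIdeal]; exact PadicInt.not_isUnit_iff.2 ha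
    rwa [← PadicInt.ker_toZMod] at this
  rcases le_or_gt ‖v‖ ‖u‖ with hle | hlt
  · have hu : u ≠ 0 := by
      rintro rfl
      have : v = 0 := by simpa using hle
      apply h; simp [this]
    have hc : ‖v / u‖ ≤ 1 := by
      rw [norm_div]; exact div_le_one_of_le₀ hle (norm_nonneg _)
    obtain ⟨c, hcc⟩ : ∃ c : ℤ_[p], (c : ℚ_[p]) = v / u := ⟨⟨v / u, hc⟩, rfl⟩
    obtain ⟨h0, h1⟩ := hassecx_nonsq p (1 - 13 * c ^ 2) (by
      intro hlt
      have := key _ hlt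
      simp only [map_sub, map_one, map_mul, map_pow, map_ofNat] at this
      have h13 : 13 * (PadicInt.toZMod c) ^ 2 = 1 := (sub_eq_zero.1 this).symm
      have hcz : (PadicInt.toZMod c) ≠ 0 := by
        intro h; rw [h] at h13; simp at h13
      exact hn ⟨(PadicInt.toZMod c)⁻¹, by field_simp; exact h13⟩)
    have e : u ^ 2 - 13 * v ^ 2 = u ^ 2 * ((1 - 13 * c ^ 2 : ℤ_[p]) : ℚ_[p]) := by
      push_cast; rw [hcc, e13]; field_simp
    rw [e, Padic.valuation_mul (pow_ne_zero _ hu) h0, h1, Padic.valuation_pow]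
    exact ⟨u.valuation, by push_cast; ring⟩
  · have hv : v ≠ 0 := by
      rintro rfl
      simp at hlt
      exact absurd hlt (not_lt.2 (norm_nonneg u))
    have hc : ‖u / v‖ ≤ 1 := by
      rw [norm_div]; exact div_le_one_of_le₀ hlt.le (norm_nonneg _)
    obtain ⟨c, hcc⟩ : ∃ c : ℤ_[p], (c : ℚ_[p]) = u / v := ⟨⟨u / v, hc⟩, rfl⟩
    obtain ⟨h0, h1⟩ := hassecx_nonsq p (c ^ 2 - 13) (by
      intro hlt
      have := key _ hlt
      simp only [map_sub, map_pow, map_ofNat] at this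
      exact hn ⟨PadicInt.toZMod c, by rw [← sq]; exact (sub_eq_zero.1 this).symm⟩)
    have e : u ^ 2 - 13 * v ^ 2 = v ^ 2 * ((c ^ 2 - 13 : ℤ_[p]) : ℚ_[p]) := by
      push_cast; rw [hcc, e13]; field_simp
    rw [e, Padic.valuation_mul (pow_ne_zero _ hv) h0, h1, Padic.valuation_pow]
    exact ⟨v.valuation, by push_cast; ring⟩

/-- Local solubility. -/
lemma hassecx_local (p : ℕ) [hp : Fact p.Prime] : ∃ x y z t : ℚ_[p],
      (x ^ 2 + 13 * y ^ 2 - 17 * z ^ 2 - 221 * t ^ 2) ^ 2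
        - 13 * (2 * x * y - 34 * z * t) ^ 2 = 25 := by
  have q17 : ((17 : ℤ) : ZMod 13) ≠ 0 ∧ IsSquare ((17 : ℤ) : ZMod 13) :=
    ⟨by decide, ⟨2, by decide⟩⟩
  have q13 : ((13 : ℤ) : ZMod 17) ≠ 0 ∧ IsSquare ((13 : ℤ) : ZMod 17) :=
    ⟨by decide, ⟨8, by decide⟩⟩
  have c13 : (∃ w : ℚ_[p], w ^ 2 = (13 : ℤ)) → ∃ x y z t : ℚ_[p],
      (x ^ 2 + 13 * y ^ 2 - 17 * z ^ 2 - 221 * t ^ 2) ^ 2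
        - 13 * (2 * x * y - 34 * z * t) ^ 2 = 25 := by
    rintro ⟨w, hw⟩
    push_cast at hw
    refine ⟨3, 2 * w / 13, 0, 0, ?_⟩
    have : (2 * w / 13) ^ 2 = 4 / 13 := by rw [div_pow, mul_pow, hw]; norm_num
    have e : (2 * 3 * (2 * w / 13) - 34 * 0 * 0) ^ 2 = 36 * (2 * w / 13) ^ 2 := by ring
    rw [e, this]; norm_num
  have c17 : (∃ w : ℚ_[p], w ^ 2 = (17 : ℤ)) → ∃ x y z t : ℚ_[p],
      (x ^ 2 + 13 * y ^ 2 - 17 * z ^ 2 - 221 * t ^ 2) ^ 2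
        - 13 * (2 * x * y - 34 * z * t) ^ 2 = 25 := by
    rintro ⟨w, hw⟩
    push_cast at hw
    refine ⟨3, 0, 2 * w / 17, 0, ?_⟩
    have : (2 * w / 17) ^ 2 = 4 / 17 := by rw [div_pow, mul_pow, hw]; norm_num
    rw [this]; norm_num
  have c221 : (∃ w : ℚ_[p], w ^ 2 = (221 : ℤ)) → ∃ x y z t : ℚ_[p],
      (x ^ 2 + 13 * y ^ 2 - 17 * z ^ 2 - 221 * t ^ 2) ^ 2
        - 13 * (2 * x * y - 34 * z * t) ^ 2 = 25 := by
    rintro ⟨w, hw⟩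
    push_cast at hw
    refine ⟨3, 0, 0, 2 * w / 221, ?_⟩
    have : (2 * w / 221) ^ 2 = 4 / 221 := by rw [div_pow, mul_pow, hw]; norm_num
    rw [this]; norm_num
  by_cases h2 : p = 2
  · subst h2; exact c17 hassecx_sqrt17_two
  by_cases h13 : p = 13
  · subst h13
    exact c17 (hassecx_sqrt_lift 13 h2 17 q17.1 q17.2)
  by_cases h17 : p = 17
  · subst h17
    exact c13 (hassecx_sqrt_lift 17 h2 13 q13.1 q13.2)
  have n13 : ((13 : ℤ) : ZMod p) ≠ 0 := by
    intro h
    rw [ZMod.intCast_zmod_eq_zero_iff_dvd] at h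
    exact h13 ((Nat.prime_dvd_prime_iff_eq hp.out (by norm_num)).1 (by exact_mod_cast h))
  have n17 : ((17 : ℤ) : ZMod p) ≠ 0 := by
    intro h
    rw [ZMod.intCast_zmod_eq_zero_iff_dvd] at h
    exact h17 ((Nat.prime_dvd_prime_iff_eq hp.out (by norm_num)).1 (by exact_mod_cast h))
  have e221 : ((221 : ℤ) : ZMod p) = ((13 : ℤ) : ZMod p) * ((17 : ℤ) : ZMod p) := by
    push_cast; norm_num
  by_cases s13 : IsSquare ((13 : ℤ) : ZMod p)
  · exact c13 (hassecx_sqrt_lift p h2 13 n13 s13)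
  by_cases s17 : IsSquare ((17 : ℤ) : ZMod p)
  · exact c17 (hassecx_sqrt_lift p h2 17 n17 s17)
  apply c221
  apply hassecx_sqrt_lift p h2 221
  · rw [e221]; exact mul_ne_zero n13 n17
  · rw [e221]
    rw [← legendreSym.eq_neg_one_iff] at s13 s17
    have n : ((221 : ℤ) : ZMod p) ≠ 0 := by rw [e221]; exact mul_ne_zero n13 n17
    have := legendreSym.mul p 13 17
    rw [s13, s17] at this
    rw [← e221]
    exact (legendreSym.eq_one_iff p n).1 (by norm_num at this; exact this)

/-- The norm to `ℚ(√221)` has even valuation at primes where 13, 17 are non-residues. -/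
lemma hassecx_gamma (p : ℕ) [hp : Fact p.Prime] (h2 : p ≠ 2)
    (h0 : ((221 : ℤ) : ZMod p) ≠ 0) (hs : IsSquare ((221 : ℤ) : ZMod p))
    (hn : ¬ IsSquare (13 : ZMod p)) (x y z t A B : ℚ)
    (hA : A = x ^ 2 + 221 * t ^ 2 - 13 * y ^ 2 - 17 * z ^ 2) (hB : B = 2 * x * t - 2 * y * z)
    (hAB : A ^ 2 - 221 * B ^ 2 = 25) :
    ∃ w : ℚ_[p], w ^ 2 = 221 ∧ (A : ℚ_[p]) + B * w ≠ 0 ∧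
      Even ((A : ℚ_[p]) + B * w).valuation := by
  obtain ⟨w, hw⟩ := hassecx_sqrt_lift p h2 221 h0 hs
  push_cast at hw
  have hA' : (A : ℚ_[p]) = x ^ 2 + 221 * t ^ 2 - 13 * y ^ 2 - 17 * z ^ 2 := by
    rw [hA]; push_cast; rfl
  have hB' : (B : ℚ_[p]) = 2 * x * t - 2 * y * z := by
    rw [hB]; push_cast; rfl
  have hAB' : (A : ℚ_[p]) ^ 2 - 221 * (B : ℚ_[p]) ^ 2 = 25 := by
    exact_mod_cast congrArg (fun q : ℚ => (q : ℚ_[p])) hAB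
  have hγ : (A : ℚ_[p]) + B * w = (x + t * w) ^ 2 - 13 * (y + z * w / 13) ^ 2 := by
    rw [hA', hB']
    linear_combination (-(t : ℚ_[p]) ^ 2 + (z : ℚ_[p]) ^ 2 / 13) * hw
  have hγ0 : (A : ℚ_[p]) + B * w ≠ 0 := by
    intro h
    have : (25 : ℚ_[p]) = 0 := by
      linear_combination (A - B * w) * h - hAB' + (B : ℚ_[p]) ^ 2 * hw
    norm_num at this
  refine ⟨w, hw, hγ0, ?_⟩
  have hev : Even ((A : ℚ_[p]) + B * w).valuation := by
    rw [hγ] at hγ0 ⊢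
    exact hassecx_even_val p hn _ _ hγ0
  exact hev

/-- Claim A: at primes where both 13 and 17 are non-residues, `2(A+5)` has even valuation. -/
lemma hassecx_claimA (p : ℕ) [hp : Fact p.Prime] (h2 : p ≠ 2)
    (h0 : ((221 : ℤ) : ZMod p) ≠ 0) (hs : IsSquare ((221 : ℤ) : ZMod p))
    (hn : ¬ IsSquare (13 : ZMod p)) (x y z t A B : ℚ)
    (hA : A = x ^ 2 + 221 * t ^ 2 - 13 * y ^ 2 - 17 * z ^ 2) (hB : B = 2 * x * t - 2 * y * z)
    (hAB : A ^ 2 - 221 * B ^ 2 = 25) (hM : 2 * (A + 5) ≠ 0) :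
    Even (padicValRat p (2 * (A + 5))) := by
  obtain ⟨w, hw, hγ0, hev⟩ := hassecx_gamma p h2 h0 hs hn x y z t A B hA hB hAB
  have hAB' : (A : ℚ_[p]) ^ 2 - 221 * (B : ℚ_[p]) ^ 2 = 25 := by
    exact_mod_cast congrArg (fun q : ℚ => (q : ℚ_[p])) hAB
  have hM' : ((2 * (A + 5) : ℚ) : ℚ_[p]) ≠ 0 := by exact_mod_cast hM
  have hprod : ((2 * (A + 5) : ℚ) : ℚ_[p]) * ((A : ℚ_[p]) + B * w) = (5 + A + B * w) ^ 2 := by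
    push_cast
    linear_combination hAB' - (B : ℚ_[p]) ^ 2 * hw
  have hval := congrArg Padic.valuation hprod
  rw [Padic.valuation_mul hM' hγ0, Padic.valuation_pow, Padic.valuation_ratCast] at hval
  obtain ⟨k, hk⟩ := hev
  rw [hk] at hval
  exact ⟨(5 + A + B * w : ℚ_[p]).valuation - k, by push_cast at hval; linarith⟩

lemma hassecx_jacobi_one (n : ℕ) (hn : 0 < n) (h13 : ¬ 13 ∣ n)
    (h : ∀ p : ℕ, p.Prime → p ∣ n → J(13 | p) = 1 ∨ Even (padicValNat p n)) :
    J(13 | n) = 1 := by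
  obtain ⟨a, b, hab, hsq⟩ := Nat.sq_mul_squarefree n
  have ha : a ≠ 0 := hsq.ne_zero
  have hb : b ≠ 0 := by rintro rfl; simp at hab; omega
  rw [← hab, jacobiSym.mul_right' _ (pow_ne_zero _ hb) ha, jacobiSym.pow_right]
  have hgcd : Int.gcd 13 b = 1 := by
    have : Nat.Coprime 13 b := by
      rw [Nat.Prime.coprime_iff_not_dvd (by norm_num)]
      intro hd; apply h13; rw [← hab]
      exact Dvd.dvd.mul_right (dvd_pow hd two_ne_zero) _
    simpa [Int.gcd] using this
  rw [jacobiSym.sq_one hgcd, one_mul]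
  have hall : ∀ q ∈ a.primeFactorsList, J(13 | q) = 1 := by
    intro q hq
    have hqp := Nat.prime_of_mem_primeFactorsList hq
    have hqa := Nat.dvd_of_mem_primeFactorsList hq
    have : Fact q.Prime := ⟨hqp⟩
    rcases h q hqp (by rw [← hab]; exact Dvd.dvd.mul_left hqa _) with h | h
    · exact h
    · exfalso
      rw [← hab, padicValNat.mul (pow_ne_zero _ hb) ha, padicValNat.pow] at h
      have h1 : padicValNat q a = 1 := by
        rw [← Nat.factorization_def a hqp]
        apply le_antisymm (hsq.natFactorization_le_one q)
        exact (hqp.dvd_iff_one_le_factorization ha).1 hqa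
      rw [h1] at h
      obtain ⟨k, hk⟩ := h
      omega
  rw [← Nat.prod_primeFactorsList ha, jacobiSym.list_prod_right
    (fun q hq => (Nat.prime_of_mem_primeFactorsList hq).ne_zero)]
  apply List.prod_eq_one
  intro c hc
  obtain ⟨q, hq, rfl⟩ := List.mem_map.1 hc
  exact hall q hq

/-- Stripping of 2 and 13. -/
lemma hassecx_strip (R S : ℤ) (hc : IsCoprime R S) :
    ∃ k e : ℤ, (k = 1 ∨ k = 4 ∨ k = 13 ∨ k = 52) ∧ R ^ 2 - 221 * S ^ 2 = k * e ∧
      Odd e ∧ J(e | 13) = 1 := by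
  have hno (q : ℤ) (hq : Prime q) (h1 : q ∣ R) (h2 : q ∣ S) : False :=
    hq.not_isUnit (hc.isUnit_of_dvd' h1 h2)
  have step2 (n : ℤ) (c : ℤ) (hn : c * n = R ^ 2 - 221 * S ^ 2) (hc2 : c = 1 ∨ c = 13) :
      ∃ k e : ℤ, (k = 1 ∨ k = 4) ∧ n = k * e ∧ Odd e := by
    rcases Int.even_or_odd' R with ⟨a, ha | ha⟩ <;> rcases Int.even_or_odd' S with ⟨b, hb | hb⟩
    · exact (hno 2 Int.prime_two ⟨a, ha⟩ ⟨b, hb⟩).elim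
    · refine ⟨1, n, Or.inl rfl, by ring, ?_⟩
      have e : R ^ 2 - 221 * S ^ 2 = 2 * (2 * a ^ 2 - 442 * b ^ 2 - 442 * b - 111) + 1 := by
        rw [ha, hb]; ring
      rw [e] at hn
      rw [Int.odd_iff]
      rcases hc2 with rfl | rfl <;> omega
    · refine ⟨1, n, Or.inl rfl, by ring, ?_⟩
      have e : R ^ 2 - 221 * S ^ 2 = 2 * (2 * a ^ 2 + 2 * a - 442 * b ^ 2) + 1 := by
        rw [ha, hb]; ring
      rw [e] at hn
      rw [Int.odd_iff]
      rcases hc2 with rfl | rfl <;> omega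
    · obtain ⟨u, hu⟩ := (Int.even_mul_succ_self a)
      obtain ⟨v, hv⟩ := (Int.even_mul_succ_self b)
      have e : R ^ 2 - 221 * S ^ 2 = 4 * (2 * (u - 221 * v - 28) + 1) := by
        rw [ha, hb]; linear_combination 4 * hu - 884 * hv
      rw [e] at hn
      refine ⟨4, n / 4, Or.inr rfl, ?_, ?_⟩
      · rcases hc2 with rfl | rfl <;> omega
      · rw [Int.odd_iff]
        rcases hc2 with rfl | rfl <;> omega
  have j4 (e : ℤ) : J(4 * e | 13) = J(e | 13) := by
    rw [jacobiSym.mul_left, show J(4 | 13) = 1 by norm_num, one_mul]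
  by_cases h : (13 : ℤ) ∣ R
  · obtain ⟨r, rfl⟩ := h
    have hS : ¬ (13 : ℤ) ∣ S := fun h => hno 13 (by norm_num) (Dvd.intro _ rfl) h
    obtain ⟨k, e, hk, hn, he⟩ := step2 (13 * r ^ 2 - 17 * S ^ 2) 13 (by ring) (Or.inr rfl)
    have hJ : J(13 * r ^ 2 - 17 * S ^ 2 | 13) = 1 := by
      rw [jacobiSym.mod_left' (a₂ := (3 * S) ^ 2) (by push_cast; ring_nf; omega)]
      apply jacobiSym.sq_one'
      rw [Int.gcd_comm, ← Int.isCoprime_iff_gcd_eq_one]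
      refine (Prime.coprime_iff_not_dvd (p := (13 : ℤ)) (by norm_num)).2 ?_
      omega
    refine ⟨13 * k, e, by omega, by rw [mul_assoc, ← hn]; ring, he, ?_⟩
    rw [hn] at hJ
    rcases hk with rfl | rfl
    · simpa using hJ
    · rwa [j4] at hJ
  · obtain ⟨k, e, hk, hn, he⟩ := step2 (R ^ 2 - 221 * S ^ 2) 1 (by ring) (Or.inl rfl)
    have hJ : J(R ^ 2 - 221 * S ^ 2 | 13) = 1 := by
      rw [jacobiSym.mod_left' (a₂ := R ^ 2) (by push_cast; omega)]
      apply jacobiSym.sq_one'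
      rw [Int.gcd_comm, ← Int.isCoprime_iff_gcd_eq_one]
      exact (Prime.coprime_iff_not_dvd (p := (13 : ℤ)) (by norm_num)).2 h
    refine ⟨k, e, by omega, hn, he, ?_⟩
    rw [hn] at hJ
    rcases hk with rfl | rfl
    · simpa using hJ
    · rwa [j4] at hJ

lemma hassecx_primitive (r s : ℚ) (hr : r ≠ 0) :
    ∃ (c : ℚ) (R S : ℤ), c ≠ 0 ∧ IsCoprime R S ∧ r = c * R ∧ s = c * S := by
  have hd : ((s / r).den : ℚ) ≠ 0 := by exact_mod_cast (s / r).den_nz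
  refine ⟨r / (s / r).den, (s / r).den, (s / r).num, div_ne_zero hr hd, ?_, ?_, ?_⟩
  · rw [Int.isCoprime_iff_gcd_eq_one, Int.gcd_comm]
    simpa [Int.gcd] using (s / r).reduced
  · push_cast; field_simp
  · have := Rat.num_div_den (s / r)
    rw [div_mul_eq_mul_div, mul_div_assoc, this]; field_simp

lemma hassecx_five : IsSquare ((221 : ℤ) : ZMod 5) ∧ ((221 : ℤ) : ZMod 5) ≠ 0 ∧
    ¬ IsSquare (13 : ZMod 5) :=
  ⟨⟨1, by decide⟩, by decide, by decide⟩

lemma hassecx_seventeen : IsSquare ((13 : ℤ) : ZMod 17) := ⟨8, by decide⟩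

lemma hassecx_global (x y z t : ℚ)
    (h : (x ^ 2 + 13 * y ^ 2 - 17 * z ^ 2 - 221 * t ^ 2) ^ 2
        - 13 * (2 * x * y - 34 * z * t) ^ 2 = 25) : False := by
  obtain ⟨A, hA⟩ : ∃ A : ℚ, A = x ^ 2 + 221 * t ^ 2 - 13 * y ^ 2 - 17 * z ^ 2 := ⟨_, rfl⟩
  obtain ⟨B, hB⟩ : ∃ B : ℚ, B = 2 * x * t - 2 * y * z := ⟨_, rfl⟩
  have hAB : A ^ 2 - 221 * B ^ 2 = 25 := by rw [hA, hB]; linear_combination h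
  have f5 : Fact (Nat.Prime 5) := ⟨by norm_num⟩
  by_cases hA5 : A + 5 = 0
  · have hA5' : A = -5 := by linarith
    have hB0 : B = 0 := by
      rw [hA5'] at hAB
      have : B ^ 2 = 0 := by linarith
      exact pow_eq_zero_iff two_ne_zero |>.1 this
    obtain ⟨w, -, -, hev⟩ := hassecx_gamma 5 (by norm_num) hassecx_five.2.1 hassecx_five.1
      hassecx_five.2.2 x y z t A B hA hB hAB
    have e : (A : ℚ_[5]) + B * w = ((-5 : ℚ) : ℚ_[5]) := by rw [hA5', hB0]; simp
    have v5 : padicValRat 5 (-5 : ℚ) = 1 := by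
      rw [padicValRat.neg]
      exact padicValRat.self (p := 5) (by norm_num)
    rw [e, Padic.valuation_ratCast, v5] at hev
    exact absurd hev (by decide)
  have hM : 2 * (A + 5) ≠ 0 := mul_ne_zero two_ne_zero hA5
  obtain ⟨c, R, S, hc, hcop, hR, hS⟩ := hassecx_primitive (A + 5) B hA5
  obtain ⟨k, e, hk, hn, hodd, hJ⟩ := hassecx_strip R S hcop
  have hk0 : k ≠ 0 := by omega
  have hnQ : (R : ℚ) ^ 2 - 221 * (S : ℚ) ^ 2 = k * e := by exact_mod_cast hn
  have hrel : (5 : ℚ) ^ 2 * (2 * (A + 5)) = c ^ 2 * (k * ((5 * e : ℤ) : ℚ)) := by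
    push_cast
    have e1 : 10 * (A + 5) = (c * R) ^ 2 - 221 * (c * S) ^ 2 := by
      rw [← hR, ← hS]; linear_combination -hAB
    linear_combination 5 * e1 + 5 * c ^ 2 * hnQ
  have he0 : e ≠ 0 := by rintro rfl; exact absurd hodd (by decide)
  have he13 : ¬ (13 : ℤ) ∣ e := by
    intro hd
    rw [jacobiSym.mod_left, show ((13 : ℕ) : ℤ) = 13 from rfl, Int.emod_eq_zero_of_dvd hd,
      jacobiSym.zero_left (by norm_num)] at hJ
    exact absurd hJ (by norm_num)
  have hodd2 : e % 2 = 1 := Int.odd_iff.1 hodd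
  have hJ1 : J(13 | 5 * e.natAbs) = 1 := by
    apply hassecx_jacobi_one
    · have := Int.natAbs_pos.2 he0; omega
    · omega
    intro p hp hpd
    have fp : Fact p.Prime := ⟨hp⟩
    have hp2 : p ≠ 2 := by rintro rfl; omega
    have hp13 : p ≠ 13 := by rintro rfl; omega
    have n13 : ((13 : ℤ) : ZMod p) ≠ 0 := by
      intro h
      rw [ZMod.intCast_zmod_eq_zero_iff_dvd] at h
      exact hp13 ((Nat.prime_dvd_prime_iff_eq hp (by norm_num)).1 (by exact_mod_cast h))
    by_cases s13 : IsSquare ((13 : ℤ) : ZMod p)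
    · left
      rw [← jacobiSym.legendreSym.to_jacobiSym]
      exact (legendreSym.eq_one_iff p n13).2 s13
    right
    have hp17 : p ≠ 17 := by
      rintro rfl
      exact s13 hassecx_seventeen
    have n221 : ((221 : ℤ) : ZMod p) ≠ 0 := by
      intro h
      rw [ZMod.intCast_zmod_eq_zero_iff_dvd] at h
      have h' : p ∣ 13 * 17 := by exact_mod_cast h
      rcases hp.dvd_mul.1 h' with h' | h'
      · exact hp13 ((Nat.prime_dvd_prime_iff_eq hp (by norm_num)).1 h')
      · exact hp17 ((Nat.prime_dvd_prime_iff_eq hp (by norm_num)).1 h')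
    have s221 : IsSquare ((221 : ℤ) : ZMod p) := by
      by_cases hp5 : p = 5
      · subst hp5; exact hassecx_five.1
      have hpe : p ∣ e.natAbs := by
        rcases hp.dvd_mul.1 hpd with h' | h'
        · exact absurd ((Nat.prime_dvd_prime_iff_eq hp (by norm_num)).1 h') hp5
        · exact h'
      have hpe' : (e : ZMod p) = 0 := by
        rw [ZMod.intCast_zmod_eq_zero_iff_dvd]; exact Int.natCast_dvd.2 hpe
      have hmod := congrArg (fun m : ℤ => (m : ZMod p)) hn
      simp only [Int.cast_sub, Int.cast_mul, Int.cast_pow, hpe', mul_zero] at hmod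
      have hS0 : (S : ZMod p) ≠ 0 := by
        intro hS0
        have hR0 : (R : ZMod p) = 0 := by
          rw [hS0] at hmod; simpa using hmod
        rw [ZMod.intCast_zmod_eq_zero_iff_dvd] at hS0 hR0
        exact (Nat.prime_iff_prime_int.1 hp).not_isUnit (hcop.isUnit_of_dvd' hR0 hS0)
      refine ⟨(R : ZMod p) / S, ?_⟩
      field_simp
      linear_combination -hmod
    have hE := hassecx_claimA p hp2 n221 s221 (by exact_mod_cast s13) x y z t A B hA hB hAB hM
    have hkp : padicValRat p (k : ℚ) = 0 := by
      rw [padicValRat.of_int]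
      have : ¬ (p : ℤ) ∣ k := by
        intro hd
        have hd' : (p : ℤ) ∣ ((2 ^ 2 * 13 : ℕ) : ℤ) := by
          refine hd.trans ?_
          rcases hk with rfl | rfl | rfl | rfl <;> norm_num
        have hd2 : p ∣ 2 ^ 2 * 13 := by exact_mod_cast hd'
        rcases hp.dvd_mul.1 hd2 with h' | h'
        · exact hp2 ((Nat.prime_dvd_prime_iff_eq hp Nat.prime_two).1 (hp.dvd_of_dvd_pow h'))
        · exact hp13 ((Nat.prime_dvd_prime_iff_eq hp (by norm_num)).1 h')
      rw [padicValInt.eq_zero_of_not_dvd this]; rfl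
    have h5e : ((5 * e : ℤ) : ℚ) ≠ 0 := by exact_mod_cast mul_ne_zero (by norm_num) he0
    have hkQ : (k : ℚ) ≠ 0 := by exact_mod_cast hk0
    have hv := congrArg (padicValRat p) hrel
    rw [padicValRat.mul (by norm_num) hM, padicValRat.mul (pow_ne_zero _ hc) (mul_ne_zero hkQ h5e),
      padicValRat.mul hkQ h5e, hkp, padicValRat.pow, padicValRat.pow,
      padicValRat.of_int, padicValInt, Int.natAbs_mul] at hv
    obtain ⟨m, hm⟩ := hE
    rw [hm] at hv
    rw [Nat.even_iff]
    change _ = _ + (_ + ((padicValNat p (5 * e.natAbs) : ℕ) : ℤ)) at hv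
    rw [Nat.cast_ofNat] at hv
    omega
  have hJ2 : J(13 | e.natAbs) = 1 := by
    have hq := jacobiSym.quadratic_reciprocity_one_mod_four (a := 13) (b := e.natAbs)
      (by norm_num) (by rw [Nat.odd_iff]; omega)
    refine Eq.trans hq ?_
    rcases Int.natAbs_eq e with h' | h'
    · rw [← h']; exact hJ
    · have : ((e.natAbs : ℕ) : ℤ) = -1 * e := by omega
      rw [this, jacobiSym.mul_left, hJ]; norm_num
  rw [jacobiSym.mul_right' _ (by norm_num) (Int.natAbs_ne_zero.2 he0), hJ2] at hJ1
  norm_num at hJ1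

/-- The norm equation `N_{ℚ(√13,√17)/ℚ}(Ξ) = 5²`, written explicitly as
`(x² + 13y² - 17z² - 221t²)² - 13(2xy - 34zt)² = 25`, is a counterexample to the Hasse
principle: it is solvable over `ℝ` and over every `ℚ_[p]`, but not over `ℚ`. -/
theorem biquadratic_norm_equation_counterexample_to_Hasse :
    (∃ x y z t : ℝ,
      (x ^ 2 + 13 * y ^ 2 - 17 * z ^ 2 - 221 * t ^ 2) ^ 2
        - 13 * (2 * x * y - 34 * z * t) ^ 2 = 25) ∧
    (∀ (p : ℕ) [Fact p.Prime], ∃ x y z t : ℚ_[p],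
      (x ^ 2 + 13 * y ^ 2 - 17 * z ^ 2 - 221 * t ^ 2) ^ 2
        - 13 * (2 * x * y - 34 * z * t) ^ 2 = 25) ∧
    ¬ (∃ x y z t : ℚ,
      (x ^ 2 + 13 * y ^ 2 - 17 * z ^ 2 - 221 * t ^ 2) ^ 2
        - 13 * (2 * x * y - 34 * z * t) ^ 2 = 25) := by
  refine ⟨⟨√5, 0, 0, 0, ?_⟩, fun p _ => hassecx_local p, ?_⟩
  · have : √5 ^ 2 = (5 : ℝ) := Real.sq_sqrt (by norm_num)
    rw [this]; norm_num
  · rintro ⟨x, y, z, t, h⟩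
    exact hassecx_global x y z t h
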